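/- Monotone decrease of the expected neighbor feature for negative node features and positive τ (key step of Theorem 4.1): for every fixed a < 0, the function τ ↦ F(a, τ) is strictly decreasing on (0, ∞); equivalently, its partial derivative in τ is negative for all τ > 0 and a < 0. -/

import Mathlib

open MeasureTheory

/-- The standard Gaussian density `φ(x) = (1/√(2π)) e^{-x²/2}`. -/
noncomputable def phi (x : ℝ) : ℝ :=
  (Real.sqrt (2 * Real.pi))⁻¹ * Real.exp (-x ^ 2 / 2)

/-- The Gauss error function `erf(z) = (2/√π) ∫₀^z e^{-t²} dt`. -/
noncomputable def erf (z : ℝ) : ℝ :=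
  (2 / Real.sqrt Real.pi) * ∫ t in (0 : ℝ)..z, Real.exp (-t ^ 2)

/-- The complementary error function `erfc(z) = 1 - erf(z)`. -/
noncomputable def erfc (z : ℝ) : ℝ := 1 - erf z

/-- The expected class-controlled feature `F(a, τ)` of a sampled neighbor of a node with
class-controlled feature `a` in the asymptotic CSBM-X model with A-X dependence strength
`τ`:
`F(a,τ) = τ (erfc((τ-a)/√2) - e^{2τa} erfc((τ+a)/√2)) / (erfc((τ-a)/√2) + e^{2τa} erfc((τ+a)/√2))`. -/
noncomputable def F (a τ : ℝ) : ℝ :=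
  τ * (erfc ((τ - a) / Real.sqrt 2) -
        Real.exp (2 * τ * a) * erfc ((τ + a) / Real.sqrt 2)) /
    (erfc ((τ - a) / Real.sqrt 2) +
      Real.exp (2 * τ * a) * erfc ((τ + a) / Real.sqrt 2))

/-- A continuous form of Chebyshev's sum inequality: if the average of the increasing function `r`
against the weight `p` is `r s₀`, then tilting `p` by a decreasing function `k` gives a smaller
average. -/
lemma setIntegral_mul_lt_of_strictMonoOn_of_strictAntiOn {p r k : ℝ → ℝ} {s₀ : ℝ}
    (hs₀ : 0 < s₀) (hp : ∀ s, 0 < s → 0 < p s)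
    (hr : StrictMonoOn r (Set.Ioi 0)) (hk : StrictAntiOn k (Set.Ioi 0))
    (ip : IntegrableOn p (Set.Ioi 0)) (irp : IntegrableOn (fun s => r s * p s) (Set.Ioi 0))
    (ikp : IntegrableOn (fun s => k s * p s) (Set.Ioi 0))
    (irkp : IntegrableOn (fun s => r s * (k s * p s)) (Set.Ioi 0))
    (hmean : ∫ s in Set.Ioi 0, r s * p s = r s₀ * ∫ s in Set.Ioi 0, p s) :
    ∫ s in Set.Ioi 0, r s * (k s * p s) < r s₀ * ∫ s in Set.Ioi 0, k s * p s := by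
  have hpos : ∀ s, 0 < s → s ≠ s₀ → 0 < (r s - r s₀) * (k s₀ - k s) * p s := by
    intro s hs hne
    refine mul_pos ?_ (hp s hs)
    rcases lt_or_gt_of_ne hne with h | h
    · exact mul_pos_of_neg_of_neg (sub_neg.2 (hr hs hs₀ h)) (sub_neg.2 (hk hs hs₀ h))
    · exact mul_pos (sub_pos.2 (hr hs₀ hs h)) (sub_pos.2 (hk hs₀ hs h))
  have hexp : (fun s => (r s - r s₀) * (k s₀ - k s) * p s) = fun s =>
      (k s₀ * (r s * p s) - k s₀ * r s₀ * p s) - (r s * (k s * p s) - r s₀ * (k s * p s)) := by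
    ext s; ring
  have i₁ : IntegrableOn (fun s => k s₀ * (r s * p s) - k s₀ * r s₀ * p s) (Set.Ioi 0) :=
    (irp.const_mul _).sub (ip.const_mul _)
  have i₂ : IntegrableOn (fun s => r s * (k s * p s) - r s₀ * (k s * p s)) (Set.Ioi 0) :=
    irkp.sub (ikp.const_mul _)
  have key : 0 < ∫ s in Set.Ioi 0, (r s - r s₀) * (k s₀ - k s) * p s := by
    rw [setIntegral_pos_iff_support_of_nonneg_ae]
    · refine lt_of_lt_of_le ?_ (measure_mono (s := Set.Ioo 0 s₀) ?_)
      · simpa using hs₀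
      · exact fun s hs => ⟨(hpos s hs.1 hs.2.ne).ne', hs.1⟩
    · filter_upwards [self_mem_ae_restrict measurableSet_Ioi] with s hs
      rcases eq_or_ne s s₀ with rfl | hne
      · simp
      · exact (hpos s hs hne).le
    · rw [hexp]
      exact i₁.sub i₂
  rw [hexp, integral_sub i₁ i₂, integral_sub (irp.const_mul _) (ip.const_mul _),
    integral_sub irkp (ikp.const_mul _), integral_const_mul, integral_const_mul,
    integral_const_mul, hmean] at key
  linarith

lemma integrable_exp_neg_sq_half_sub (x : ℝ) :
    Integrable fun s : ℝ => Real.exp (-s ^ 2 / 2 - s * x) := by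
  have h := ((integrable_exp_neg_mul_sq (b := 1 / 2) (by norm_num)).comp_add_right x).const_mul
    (Real.exp (x ^ 2 / 2))
  refine h.congr (.of_forall fun s => ?_)
  simp only [← Real.exp_add]
  ring_nf

lemma integrable_mul_exp_neg_sq_half_sub (x : ℝ) :
    Integrable fun s : ℝ => s * Real.exp (-s ^ 2 / 2 - s * x) := by
  have h := ((integrable_mul_exp_neg_mul_sq (b := 1 / 2) (by norm_num)).comp_add_right x).const_mul
    (Real.exp (x ^ 2 / 2))
  refine (h.sub ((integrable_exp_neg_sq_half_sub x).const_mul x)).congr (.of_forall fun s => ?_)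
  have : Real.exp (-s ^ 2 / 2 - s * x)
      = Real.exp (x ^ 2 / 2) * Real.exp (-(1 / 2) * (s + x) ^ 2) := by
    rw [← Real.exp_add]; ring_nf
  simp only [Pi.sub_apply, this]
  ring

/-- The Mills ratio of the standard Gaussian, `e^{x²/2} ∫_x^∞ e^{-t²/2} dt`, in Laplace form. -/
noncomputable def mills (x : ℝ) : ℝ := ∫ s in Set.Ioi (0 : ℝ), Real.exp (-s ^ 2 / 2 - s * x)

lemma mills_pos (x : ℝ) : 0 < mills x := by
  unfold mills
  rw [setIntegral_pos_iff_support_of_nonneg_ae (.of_forall fun s => (Real.exp_pos _).le)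
    (integrable_exp_neg_sq_half_sub x).integrableOn,
    show Function.support (fun s : ℝ => Real.exp (-s ^ 2 / 2 - s * x)) = Set.univ from
      Set.eq_univ_of_forall fun s => (Real.exp_pos _).ne']
  simp

lemma integral_Ioi_mul_exp_neg_sq_half_sub (x : ℝ) :
    ∫ s in Set.Ioi (0 : ℝ), s * Real.exp (-s ^ 2 / 2 - s * x) = 1 - x * mills x := by
  have i₁ := (integrable_mul_exp_neg_sq_half_sub x).integrableOn (s := Set.Ioi 0)
  have i₂ := ((integrable_exp_neg_sq_half_sub x).const_mul x).integrableOn (s := Set.Ioi 0)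
  have hderiv : ∀ s ∈ Set.Ici (0 : ℝ), HasDerivAt (fun s => -Real.exp (-s ^ 2 / 2 - s * x))
      (s * Real.exp (-s ^ 2 / 2 - s * x) + x * Real.exp (-s ^ 2 / 2 - s * x)) s := by
    intro s _
    have h₁ : HasDerivAt (fun s : ℝ => -s ^ 2 / 2 - s * x) (-s - x) s := by
      have h := (((hasDerivAt_id s).pow 2).neg.div_const 2).sub ((hasDerivAt_id s).mul_const x)
      refine h.congr_deriv ?_
      simp only [id]
      norm_num
      ring
    refine h₁.exp.neg.congr_deriv ?_
    ring
  have htend : Filter.Tendsto (fun s : ℝ => -Real.exp (-s ^ 2 / 2 - s * x)) Filter.atTop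
      (nhds 0) := by
    rw [← neg_zero]
    refine (Real.tendsto_exp_atBot.comp ?_).neg
    have h := (Filter.tendsto_id (α := ℝ) (x := Filter.atTop)).atTop_mul_atTop₀
      (Filter.tendsto_atTop_add_const_right Filter.atTop (2 * x) Filter.tendsto_id)
    have h' := Filter.tendsto_neg_atTop_atBot.comp (h.atTop_div_const (r := 2) (by norm_num))
    refine h'.congr fun s => ?_
    simp only [Function.comp_apply, id]
    ring
  have h := integral_Ioi_of_hasDerivAt_of_tendsto' hderiv (i₁.add i₂) htend
  rw [integral_add i₁ i₂, integral_const_mul] at h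
  simp at h
  unfold mills
  linarith

lemma erfc_eq_integral_Ioi (z : ℝ) :
    erfc z = 2 / Real.sqrt Real.pi * ∫ t in Set.Ioi z, Real.exp (-t ^ 2) := by
  have hi : Integrable fun t : ℝ => Real.exp (-t ^ 2) := by
    simpa using integrable_exp_neg_mul_sq (b := 1) one_pos
  have hg : ∫ t in Set.Ioi (0 : ℝ), Real.exp (-t ^ 2) = Real.sqrt Real.pi / 2 := by
    simpa using integral_gaussian_Ioi 1
  have hs := intervalIntegral.integral_interval_add_Ioi (a := 0) (b := z) hi.integrableOn
    hi.integrableOn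
  have hπ : Real.sqrt Real.pi ≠ 0 := (Real.sqrt_pos.2 Real.pi_pos).ne'
  rw [hg] at hs
  rw [erfc, erf, eq_sub_of_add_eq hs]
  field_simp
  ring

lemma erfc_div_sqrt_two (x : ℝ) :
    erfc (x / Real.sqrt 2)
      = 2 / Real.sqrt Real.pi / Real.sqrt 2 * Real.exp (-x ^ 2 / 2) * mills x := by
  have h2 : 0 < (Real.sqrt 2)⁻¹ := by positivity
  have hscale := integral_comp_mul_left_Ioi' (fun t : ℝ => Real.exp (-t ^ 2)) x h2
  have hshift := (measurePreserving_add_right volume x).setIntegral_preimage_emb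
    (measurableEmbedding_addRight x) (fun u : ℝ => Real.exp (-((Real.sqrt 2)⁻¹ * u) ^ 2))
    (Set.Ioi x)
  rw [erfc_eq_integral_Ioi, div_eq_inv_mul x, ← hscale, ← hshift, mills,
    mul_assoc _ _ (integral _ _), ← integral_const_mul]
  simp only [Set.preimage_add_const_Ioi, sub_self, smul_eq_mul]
  rw [div_eq_mul_inv _ (Real.sqrt 2), mul_assoc]
  congr 3
  ext s
  rw [← Real.exp_add, mul_pow, inv_pow, Real.sq_sqrt (by norm_num)]
  ring_nf

lemma F_eq_mills (a τ : ℝ) :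
    F a τ = τ * (mills (τ - a) - mills (τ + a)) / (mills (τ - a) + mills (τ + a)) := by
  have hc : 2 / Real.sqrt Real.pi / Real.sqrt 2 * Real.exp (-(τ - a) ^ 2 / 2) ≠ 0 := by
    have := Real.pi_pos
    positivity
  have he : Real.exp (2 * τ * a) * erfc ((τ + a) / Real.sqrt 2)
      = 2 / Real.sqrt Real.pi / Real.sqrt 2 * Real.exp (-(τ - a) ^ 2 / 2) * mills (τ + a) := by
    rw [erfc_div_sqrt_two,
      show -(τ - a) ^ 2 / 2 = 2 * τ * a + -(τ + a) ^ 2 / 2 by ring, Real.exp_add]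
    ring
  rw [F, he, erfc_div_sqrt_two, ← mul_sub, ← mul_add, mul_left_comm, mul_div_mul_left _ _ hc]

lemma exp_mul_cosh_eq (b τ s : ℝ) :
    Real.exp (-s ^ 2 / 2 - s * τ) * Real.cosh (b * s)
      = (Real.exp (-s ^ 2 / 2 - s * (τ - b)) + Real.exp (-s ^ 2 / 2 - s * (τ + b))) / 2 := by
  rw [Real.cosh_eq, mul_div_assoc', mul_add, ← Real.exp_add, ← Real.exp_add]
  ring_nf

lemma mul_exp_mul_sinh_eq (b τ s : ℝ) :
    s * (Real.exp (-s ^ 2 / 2 - s * τ) * Real.sinh (b * s))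
      = (s * Real.exp (-s ^ 2 / 2 - s * (τ - b))
          - s * Real.exp (-s ^ 2 / 2 - s * (τ + b))) / 2 := by
  rw [Real.sinh_eq, mul_div_assoc', mul_sub, ← Real.exp_add, ← Real.exp_add]
  ring_nf

lemma integrable_exp_mul_cosh (b τ : ℝ) :
    Integrable fun s : ℝ => Real.exp (-s ^ 2 / 2 - s * τ) * Real.cosh (b * s) := by
  simp only [exp_mul_cosh_eq]
  exact ((integrable_exp_neg_sq_half_sub _).add (integrable_exp_neg_sq_half_sub _)).div_const 2

lemma integrable_mul_exp_mul_sinh (b τ : ℝ) :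
    Integrable fun s : ℝ => s * (Real.exp (-s ^ 2 / 2 - s * τ) * Real.sinh (b * s)) := by
  simp only [mul_exp_mul_sinh_eq]
  exact ((integrable_mul_exp_neg_sq_half_sub _).sub
    (integrable_mul_exp_neg_sq_half_sub _)).div_const 2

lemma integral_exp_mul_cosh (b τ : ℝ) :
    ∫ s in Set.Ioi (0 : ℝ), Real.exp (-s ^ 2 / 2 - s * τ) * Real.cosh (b * s)
      = (mills (τ - b) + mills (τ + b)) / 2 := by
  simp only [exp_mul_cosh_eq]
  rw [integral_div, integral_add (integrable_exp_neg_sq_half_sub _).integrableOn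
    (integrable_exp_neg_sq_half_sub _).integrableOn, mills, mills]

lemma integral_mul_exp_mul_sinh (b τ : ℝ) :
    ∫ s in Set.Ioi (0 : ℝ), s * (Real.exp (-s ^ 2 / 2 - s * τ) * Real.sinh (b * s))
      = (τ * (mills (τ + b) - mills (τ - b)) + b * (mills (τ + b) + mills (τ - b))) / 2 := by
  simp only [mul_exp_mul_sinh_eq]
  rw [integral_div, integral_sub (integrable_mul_exp_neg_sq_half_sub _).integrableOn
    (integrable_mul_exp_neg_sq_half_sub _).integrableOn, integral_Ioi_mul_exp_neg_sq_half_sub,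
    integral_Ioi_mul_exp_neg_sq_half_sub]
  ring

/-- `F(-b, τ) + b` is the mean of `s tanh (b s)` under the density proportional to
`e^{-s²/2 - sτ} cosh (b s)` on `(0, ∞)`. -/
lemma F_neg_add_eq_integral_div (b τ : ℝ) :
    F (-b) τ + b
      = (∫ s in Set.Ioi (0 : ℝ), s * (Real.exp (-s ^ 2 / 2 - s * τ) * Real.sinh (b * s)))
        / ∫ s in Set.Ioi (0 : ℝ), Real.exp (-s ^ 2 / 2 - s * τ) * Real.cosh (b * s) := by
  have h₁ := mills_pos (τ + b)
  have h₂ := mills_pos (τ - b)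
  rw [F_eq_mills, integral_mul_exp_mul_sinh, integral_exp_mul_cosh, sub_neg_eq_add,
    ← sub_eq_add_neg]
  field_simp
  ring

lemma Real.tanh_lt_tanh_of_lt {x y : ℝ} (h : x < y) : Real.tanh x < Real.tanh y := by
  rw [Real.tanh_eq_sinh_div_cosh, Real.tanh_eq_sinh_div_cosh,
    div_lt_div_iff₀ (Real.cosh_pos x) (Real.cosh_pos y)]
  have := Real.sinh_pos_iff.2 (sub_pos.2 h)
  rw [Real.sinh_sub] at this
  linarith

lemma strictMonoOn_mul_tanh {b : ℝ} (hb : 0 < b) :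
    StrictMonoOn (fun s => s * Real.tanh (b * s)) (Set.Ioi 0) := by
  intro x hx y hy hxy
  have hx : 0 < x := hx
  have h₀ : 0 < Real.tanh (b * x) := by
    simpa using Real.tanh_lt_tanh_of_lt (mul_pos hb hx)
  exact mul_lt_mul'' hxy (Real.tanh_lt_tanh_of_lt (mul_lt_mul_of_pos_left hxy hb)) hx.le h₀.le

lemma exists_mul_tanh_eq {b m : ℝ} (hb : 0 < b) (hm : 0 < m) :
    ∃ s, 0 < s ∧ s * Real.tanh (b * s) = m := by
  have hT : 0 < Real.tanh b := by simpa using Real.tanh_lt_tanh_of_lt hb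
  set S := 1 + m / Real.tanh b with hS
  have hmT : 0 < m / Real.tanh b := div_pos hm hT
  have hcont : Continuous fun s : ℝ => s * Real.tanh (b * s) := by
    simp only [Real.tanh_eq_sinh_div_cosh]
    exact continuous_id.mul ((Real.continuous_sinh.comp (continuous_const_mul b)).div
      (Real.continuous_cosh.comp (continuous_const_mul b)) fun s => (Real.cosh_pos _).ne')
  have hle : m ≤ S * Real.tanh (b * S) := by
    have h₁ : Real.tanh b < Real.tanh (b * S) := Real.tanh_lt_tanh_of_lt (by nlinarith)
    have h₂ : S * Real.tanh b = Real.tanh b + m := by rw [hS]; field_simp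
    nlinarith
  obtain ⟨s, hs, hsm⟩ := intermediate_value_Icc (show (0 : ℝ) ≤ S by linarith) hcont.continuousOn
    (show m ∈ Set.Icc _ _ from ⟨by simpa using hm.le, hle⟩)
  refine ⟨s, lt_of_le_of_ne hs.1 ?_, hsm⟩
  rintro rfl
  simp at hsm
  exact hm.ne hsm

/-- key step of Theorem 4.1: for every fixed `a < 0`, the map
`τ ↦ F(a, τ)` is strictly decreasing on `(0, ∞)`. -/
theorem expected_neighbor_feature_strictAnti (a : ℝ) (ha : a < 0) :
    StrictAntiOn (fun τ => F a τ) (Set.Ioi (0 : ℝ)) := by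
  intro τ₁ _ τ₂ _ hτ
  obtain ⟨b, rfl⟩ : ∃ b, a = -b := ⟨-a, by ring⟩
  have hb : 0 < b := by linarith
  have hden : ∀ τ, 0 < ∫ s in Set.Ioi (0 : ℝ),
      Real.exp (-s ^ 2 / 2 - s * τ) * Real.cosh (b * s) := fun τ => by
    rw [integral_exp_mul_cosh]
    exact half_pos (add_pos (mills_pos _) (mills_pos _))
  have hnum : 0 < ∫ s in Set.Ioi (0 : ℝ),
      s * (Real.exp (-s ^ 2 / 2 - s * τ₁) * Real.sinh (b * s)) := by
    have hpos : ∀ s ∈ Set.Ioi (0 : ℝ),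
        0 < s * (Real.exp (-s ^ 2 / 2 - s * τ₁) * Real.sinh (b * s)) := fun s hs =>
      mul_pos hs (mul_pos (Real.exp_pos _) (Real.sinh_pos_iff.2 (mul_pos hb hs)))
    rw [setIntegral_pos_iff_support_of_nonneg_ae
      ((ae_restrict_mem measurableSet_Ioi).mono fun s hs => (hpos s hs).le)
      (integrable_mul_exp_mul_sinh b τ₁).integrableOn,
      Set.inter_eq_self_of_subset_right (t := Set.Ioi (0 : ℝ)) ?_]
    · simp
    · exact fun s hs => (hpos s hs).ne'
  obtain ⟨s₀, hs₀, hs₀m⟩ := exists_mul_tanh_eq hb (div_pos hnum (hden τ₁))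
  have hcosh : ∀ s, Real.exp (-s * (τ₂ - τ₁)) * (Real.exp (-s ^ 2 / 2 - s * τ₁) * Real.cosh (b * s))
      = Real.exp (-s ^ 2 / 2 - s * τ₂) * Real.cosh (b * s) := fun s => by
    rw [← mul_assoc, ← Real.exp_add]; ring_nf
  have hsinh : ∀ τ s, s * Real.tanh (b * s) * (Real.exp (-s ^ 2 / 2 - s * τ) * Real.cosh (b * s))
      = s * (Real.exp (-s ^ 2 / 2 - s * τ) * Real.sinh (b * s)) := fun τ s => by
    have := (Real.cosh_pos (b * s)).ne'
    rw [Real.tanh_eq_sinh_div_cosh]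
    field_simp
  have hlt := setIntegral_mul_lt_of_strictMonoOn_of_strictAntiOn
    (p := fun s => Real.exp (-s ^ 2 / 2 - s * τ₁) * Real.cosh (b * s))
    (k := fun s => Real.exp (-s * (τ₂ - τ₁))) hs₀
    (fun s _ => mul_pos (Real.exp_pos _) (Real.cosh_pos _)) (strictMonoOn_mul_tanh hb)
    (fun x _ y _ hxy => Real.exp_lt_exp.2 (by nlinarith))
    (integrable_exp_mul_cosh b τ₁).integrableOn
    (by simpa only [hsinh] using (integrable_mul_exp_mul_sinh b τ₁).integrableOn)
    (by simpa only [hcosh] using (integrable_exp_mul_cosh b τ₂).integrableOn)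
    (by simpa only [hcosh, hsinh] using (integrable_mul_exp_mul_sinh b τ₂).integrableOn)
    (by simp only [hsinh]; rw [hs₀m, div_mul_cancel₀ _ (hden τ₁).ne'])
  simp only [hcosh, hsinh] at hlt
  rw [hs₀m, ← div_lt_iff₀ (hden τ₂), ← F_neg_add_eq_integral_div,
    ← F_neg_add_eq_integral_div] at hlt
  exact lt_of_add_lt_add_right hlt
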